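/- arXiv:2305.04688 — 3 statements merged into one kernel-verified Lean document; each statement's English description precedes it below -/
import Mathlib

section
/- Let P be a stochastic matrix on a finite set 𝒳, monotone with respect to a partial order ⪯ connecting 𝒳, and let f : 𝒳 → ℝ be strictly increasing. Then for every pair x ⪯ y (in particular for every covering pair x ⊲ y), the Wasserstein distance with respect to the path metric ρ_f satisfies W(P(x,·), P(y,·)) = Pf(y) − Pf(x), and ρ_f(x,y) = f(y) − f(x). -/
/-- `ρ` is a metric on `X`. -/
def IsMetric {X : Type*} (ρ : X → X → ℝ) : Prop :=
  (∀ x y, ρ x y = 0 ↔ x = y) ∧ (∀ x y, ρ x y = ρ y x) ∧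
    (∀ x y, 0 ≤ ρ x y) ∧ ∀ x y z, ρ x z ≤ ρ x y + ρ y z

/-- `μ` is a probability vector on `X`. -/
def IsProbVec {X : Type*} [Fintype X] (μ : X → ℝ) : Prop :=
  (∀ x, 0 ≤ μ x) ∧ ∑ x, μ x = 1

/-- `π` is a coupling of `μ` and `ν`. -/
def IsCoupling {X : Type*} [Fintype X] (μ ν : X → ℝ) (π : X → X → ℝ) : Prop :=
  (∀ x y, 0 ≤ π x y) ∧ (∀ x, ∑ y, π x y = μ x) ∧ ∀ y, ∑ x, π x y = ν y

/-- The Wasserstein distance between `μ` and `ν` for the cost `ρ`: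
the infimum over couplings of the expected distance. -/
noncomputable def wass {X : Type*} [Fintype X] (ρ : X → X → ℝ) (μ ν : X → ℝ) : ℝ :=
  sInf {c : ℝ | ∃ π : X → X → ℝ, IsCoupling μ ν π ∧ c = ∑ x, ∑ y, π x y * ρ x y}

/-- Adjacency in the Hasse diagram of the poset `X`: `x ⋖ y` or `y ⋖ x`. -/
def HasseAdj {X : Type*} [PartialOrder X] (x y : X) : Prop := x ⋖ y ∨ y ⋖ x

/-- The path metric `ρ_f` induced by `f` on the Hasse diagram: the minimum over paths
`σ = (σ₀, …, σ_ℓ)` from `x` to `y` of `∑ᵢ |f(σᵢ) - f(σᵢ₋₁)|`. -/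
noncomputable def pathMetric {X : Type*} [PartialOrder X] (f : X → ℝ) (x y : X) : ℝ :=
  sInf {c : ℝ | ∃ σ : List X, List.Chain HasseAdj x σ ∧
    (x :: σ).getLast (List.cons_ne_nil x σ) = y ∧
    c = (((x :: σ).zip σ).map (fun p => |f p.2 - f p.1|)).sum}

open Matrix

/-- `P` is a stochastic matrix: nonnegative entries and rows summing to one. -/
def IsStochastic {X : Type*} [Fintype X] (P : Matrix X X ℝ) : Prop :=
  (∀ x y, 0 ≤ P x y) ∧ ∀ x, ∑ y, P x y = 1

/-- The partial order connects `X`. -/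
def Connects (X : Type*) [PartialOrder X] : Prop :=
  ∀ x y : X, Relation.ReflTransGen (fun a b : X => a ≤ b ∨ b ≤ a) x y

/-- `P` is monotone: `Pf` is increasing for every increasing `f`. -/
def IsMonotoneMatrix {X : Type*} [Fintype X] [PartialOrder X] (P : Matrix X X ℝ) : Prop :=
  ∀ f : X → ℝ, Monotone f → Monotone (P.mulVec f)

section Strassen

variable {X : Type*} [Fintype X] [PartialOrder X]

open Classical in
/-- Pairs of Dirac masses at comparable points. -/
noncomputable def diracPair (p : {p : X × X // p.1 ≤ p.2}) : (X → ℝ) × (X → ℝ) :=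
  (Pi.single p.1.1 1, Pi.single p.1.2 1)

lemma exists_coupling_of_mem_convexHull {μ ν : X → ℝ}
    (h : (μ, ν) ∈ convexHull ℝ (Set.range (diracPair (X := X)))) :
    ∃ π : X → X → ℝ, IsCoupling μ ν π ∧ ∀ a b, ¬ a ≤ b → π a b = 0 := by
  classical
  let S : Set ((X → ℝ) × (X → ℝ)) :=
    {q | ∃ π : X → X → ℝ, IsCoupling q.1 q.2 π ∧ ∀ a b, ¬ a ≤ b → π a b = 0}
  have hS : Convex ℝ S := by
    rintro ⟨μ₁, ν₁⟩ ⟨π₁, ⟨hp₁, hr₁, hc₁⟩, hs₁⟩ ⟨μ₂, ν₂⟩ ⟨π₂, ⟨hp₂, hr₂, hc₂⟩, hs₂⟩ s t hs ht -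
    refine ⟨fun a b => s * π₁ a b + t * π₂ a b, ⟨fun a b => ?_, fun a => ?_, fun b => ?_⟩,
      fun a b hab => by simp [hs₁ a b hab, hs₂ a b hab]⟩
    · have := hp₁ a b
      have := hp₂ a b
      positivity
    · simp [Finset.sum_add_distrib, ← Finset.mul_sum, hr₁, hr₂]
    · simp [Finset.sum_add_distrib, ← Finset.mul_sum, hc₁, hc₂]
  have hsub : Set.range (diracPair (X := X)) ⊆ S := by
    rintro _ ⟨⟨⟨x, y⟩, hxy⟩, rfl⟩
    refine ⟨fun a b => if a = x ∧ b = y then 1 else 0,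
      ⟨fun a b => by dsimp only; split_ifs <;> norm_num, fun a => ?_, fun b => ?_⟩, fun a b hab => ?_⟩
    · by_cases h : a = x <;> simp [diracPair, h]
    · by_cases h : b = y <;> simp [diracPair, h]
    · refine if_neg ?_
      rintro ⟨rfl, rfl⟩
      exact hab hxy
  exact convexHull_min hsub hS h

/-- **Strassen's theorem** on a finite poset: stochastic domination yields a coupling supported
on comparable pairs. -/
theorem exists_monotone_coupling {μ ν : X → ℝ} (hμ : IsProbVec μ) (hν : IsProbVec ν)
    (hdom : ∀ φ : X → ℝ, Monotone φ → ∑ a, μ a * φ a ≤ ∑ a, ν a * φ a) :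
    ∃ π : X → X → ℝ, IsCoupling μ ν π ∧ ∀ a b, ¬ a ≤ b → π a b = 0 := by
  classical
  apply exists_coupling_of_mem_convexHull
  by_contra hmem
  obtain ⟨l, u, hlt, hu⟩ := geometric_hahn_banach_closed_point
    (convex_convexHull ℝ _) ((Set.finite_range (diracPair (X := X))).isClosed_convexHull ℝ) hmem
  let g : X → ℝ := fun a => l (Pi.single a 1, 0)
  let h : X → ℝ := fun b => l (0, Pi.single b 1)
  have hl : ∀ α β : X → ℝ, l (α, β) = ∑ a, α a * g a + ∑ b, β b * h b := by
    intro α β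
    have e : (α, β) = ∑ a, α a • ((Pi.single a 1, 0) : (X → ℝ) × (X → ℝ)) +
        ∑ b, β b • ((0, Pi.single b 1) : (X → ℝ) × (X → ℝ)) := by
      ext i <;> simp [Prod.fst_sum, Prod.snd_sum, Finset.sum_apply, Pi.single_apply]
    rw [e]
    simp only [map_add, map_sum, map_smul, smul_eq_mul, g, h]
  have hgh : ∀ a b, a ≤ b → g a + h b < u := by
    intro a b hab
    have := hlt _ (subset_convexHull ℝ _ ⟨⟨(a, b), hab⟩, rfl⟩)
    simpa [diracPair, hl, Pi.single_apply] using this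
  have hne : ∀ a : X, (Finset.univ.filter (a ≤ ·)).Nonempty := fun a => ⟨a, by simp⟩
  let φ : X → ℝ := fun a => (Finset.univ.filter (a ≤ ·)).sup' (hne a) h
  have hφ : Monotone fun a => -φ a := by
    intro a b hab
    refine neg_le_neg (Finset.sup'_mono _ (fun c hc => ?_) _)
    simp only [Finset.mem_filter, Finset.mem_univ, true_and] at hc ⊢
    exact hab.trans hc
  have hhφ : ∀ b, h b ≤ φ b := fun b => Finset.le_sup' h (by simp)
  have hgφ : ∀ a, g a ≤ u - φ a := by
    intro a
    obtain ⟨b, hb, hb'⟩ := Finset.exists_mem_eq_sup' (hne a) h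
    have := hgh a b (by simpa using hb)
    change φ a = h b at hb'
    linarith
  have h₁ : ∑ a, μ a * g a ≤ ∑ a, μ a * (u - φ a) :=
    Finset.sum_le_sum fun a _ => mul_le_mul_of_nonneg_left (hgφ a) (hμ.1 a)
  have h₂ : ∑ b, ν b * h b ≤ ∑ b, ν b * φ b :=
    Finset.sum_le_sum fun b _ => mul_le_mul_of_nonneg_left (hhφ b) (hν.1 b)
  have h₃ := hdom _ hφ
  simp only [mul_neg, Finset.sum_neg_distrib] at h₃
  simp only [mul_sub, Finset.sum_sub_distrib, ← Finset.sum_mul, hμ.2, one_mul] at h₁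
  rw [hl] at hu
  linarith

end Strassen

section PathMetric

lemma sub_le_chain_length {X : Type*} (f : X → ℝ) (σ : List X) (x : X) :
    f ((x :: σ).getLast (List.cons_ne_nil x σ)) - f x ≤
      (((x :: σ).zip σ).map (fun p => |f p.2 - f p.1|)).sum := by
  induction σ generalizing x with
  | nil => simp
  | cons z σ ih =>
    have h₁ := ih z
    have h₂ := le_abs_self (f z - f x)
    rw [List.getLast_cons (List.cons_ne_nil z σ), List.zip_cons_cons, List.map_cons,
      List.sum_cons]
    linarith

variable {X : Type*} [PartialOrder X]

lemma exists_chain_of_le [Finite X] {f : X → ℝ} (hf : Monotone f) {x y : X} (hxy : x ≤ y) :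
    ∃ σ : List X, List.Chain HasseAdj x σ ∧
      (x :: σ).getLast (List.cons_ne_nil x σ) = y ∧
      f y - f x = (((x :: σ).zip σ).map (fun p => |f p.2 - f p.1|)).sum := by
  classical
  have := Fintype.ofFinite X
  let := Fintype.toLocallyFiniteOrder (α := X)
  induction le_iff_reflTransGen_covBy.mp hxy using Relation.ReflTransGen.head_induction_on with
  | refl => exact ⟨[], List.IsChain.singleton _, rfl, by simp⟩
  | @head a c hac hcy ih =>
    obtain ⟨σ, h₁, h₂, h₃⟩ := ih (le_iff_reflTransGen_covBy.mpr hcy)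
    refine ⟨c :: σ, List.IsChain.cons_cons (.inl hac) h₁, ?_, ?_⟩
    · rwa [List.getLast_cons (List.cons_ne_nil c σ)]
    · rw [List.zip_cons_cons, List.map_cons, List.sum_cons, ← h₃,
        abs_of_nonneg (sub_nonneg.mpr (hf hac.le))]
      ring

lemma exists_chain_of_reflTransGen {x y : X} (h : Relation.ReflTransGen HasseAdj x y) :
    ∃ σ : List X, List.Chain HasseAdj x σ ∧
      (x :: σ).getLast (List.cons_ne_nil x σ) = y := by
  induction h using Relation.ReflTransGen.head_induction_on with
  | refl => exact ⟨[], List.IsChain.singleton _, rfl⟩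
  | @head a c hac _ ih =>
    obtain ⟨σ, h₁, h₂⟩ := ih
    exact ⟨c :: σ, List.IsChain.cons_cons hac h₁, by
      rwa [List.getLast_cons (List.cons_ne_nil c σ)]⟩

lemma Connects.reflTransGen_hasseAdj [Finite X] (hconn : Connects X) (x y : X) :
    Relation.ReflTransGen HasseAdj x y := by
  classical
  have := Fintype.ofFinite X
  let := Fintype.toLocallyFiniteOrder (α := X)
  have hle : ∀ a b : X, a ≤ b → Relation.ReflTransGen HasseAdj a b := fun a b hab =>
    Relation.ReflTransGen.mono (fun _ _ => Or.inl) _ _ (le_iff_reflTransGen_covBy.mp hab)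
  have : Std.Symm (HasseAdj (X := X)) := ⟨fun _ _ => Or.symm⟩
  induction hconn x y with
  | refl => exact .refl
  | tail _ h ih =>
    refine ih.trans ?_
    rcases h with h | h
    · exact hle _ _ h
    · exact Std.Symm.symm _ _ (hle _ _ h)

lemma sub_le_pathMetric [Finite X] (hconn : Connects X) (f : X → ℝ) (x y : X) :
    f y - f x ≤ pathMetric f x y := by
  obtain ⟨σ, h₁, h₂⟩ := exists_chain_of_reflTransGen (hconn.reflTransGen_hasseAdj x y)
  refine le_csInf ⟨_, σ, h₁, h₂, rfl⟩ ?_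
  rintro _ ⟨τ, -, rfl, rfl⟩
  exact sub_le_chain_length f τ x

lemma pathMetric_of_le [Finite X] {f : X → ℝ} (hf : Monotone f) {x y : X} (hxy : x ≤ y) :
    pathMetric f x y = f y - f x := by
  refine IsLeast.csInf_eq ⟨exists_chain_of_le hf hxy, ?_⟩
  rintro _ ⟨τ, -, rfl, rfl⟩
  exact sub_le_chain_length f τ x

end PathMetric

lemma IsCoupling.sum_mul_sub {X : Type*} [Fintype X] {μ ν : X → ℝ} {π : X → X → ℝ}
    (h : IsCoupling μ ν π) (f : X → ℝ) :
    ∑ a, ∑ b, π a b * (f b - f a) = ∑ b, ν b * f b - ∑ a, μ a * f a := by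
  simp only [mul_sub, Finset.sum_sub_distrib]
  rw [Finset.sum_comm]
  simp only [← Finset.sum_mul, h.2.1, h.2.2]

/-- **Wasserstein distance between rows of a monotone matrix.** With respect to the path
metric `ρ_f`, for `x ⪯ y` we have `W(P(x,·), P(y,·)) = Pf(y) - Pf(x)` and
`ρ_f(x,y) = f(y) - f(x)`. -/
theorem wass_rows_of_monotone {X : Type*} [Fintype X] [PartialOrder X]
    (P : Matrix X X ℝ) (hstoch : IsStochastic P) (hconn : Connects X)
    (hmono : IsMonotoneMatrix P) (f : X → ℝ) (hf : StrictMono f) :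
    ∀ x y : X, x ≤ y →
      wass (pathMetric f) (P x) (P y) = P.mulVec f y - P.mulVec f x ∧
        pathMetric f x y = f y - f x := by
  intro x y hxy
  refine ⟨?_, pathMetric_of_le hf.monotone hxy⟩
  obtain ⟨π, hπ, hsupp⟩ := exists_monotone_coupling ⟨hstoch.1 x, hstoch.2 x⟩
    ⟨hstoch.1 y, hstoch.2 y⟩ (fun φ hφ => hmono φ hφ hxy)
  refine IsLeast.csInf_eq ⟨⟨π, hπ, ?_⟩, ?_⟩
  · refine (hπ.sum_mul_sub f).symm.trans ?_
    refine Finset.sum_congr rfl fun a _ => Finset.sum_congr rfl fun b _ => ?_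
    by_cases hab : a ≤ b
    · rw [pathMetric_of_le hf.monotone hab]
    · simp [hsupp a b hab]
  · rintro _ ⟨π', hπ', rfl⟩
    refine (hπ'.sum_mul_sub f).symm.trans_le ?_
    exact Finset.sum_le_sum fun a _ => Finset.sum_le_sum fun b _ =>
      mul_le_mul_of_nonneg_left (sub_le_pathMetric hconn f a b) (hπ'.1 a b)
end

section
/- Consider the non-conservative exclusion process generator L with Laplace matrix Δ. Let λ ∈ ℝ and v ∈ ℝ^n satisfy Δv = −λv, and set p = (−Δ)^{-1} r^+. Then the function f : {0,1}^n → ℝ defined by f(x) = Σ_i v_i (x_i − p_i) satisfies Lf = −λ f. -/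
/-- Action of the non-conservative exclusion generator on a function `f : {0,1}^n → ℝ`:
exchanges at rates `c i j`, creations at rates `rp i`, annihilations at rates `rm i`. -/
noncomputable def exclusionOp {n : ℕ} (c : Fin n → Fin n → ℝ) (rp rm : Fin n → ℝ)
    (f : (Fin n → Bool) → ℝ) (x : Fin n → Bool) : ℝ :=
  (1 / 2) * ∑ i, ∑ j, c i j * (f (x ∘ Equiv.swap i j) - f x)
    + ∑ i, rp i * (f (Function.update x i true) - f x)
    + ∑ i, rm i * (f (Function.update x i false) - f x)

/-- The exclusion generator as a matrix on the state space `{0,1}^n`, obtained by letting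
the exclusion operator act on indicator functions. -/
noncomputable def exclusionGen {n : ℕ} (c : Fin n → Fin n → ℝ) (rp rm : Fin n → ℝ) :
    Matrix (Fin n → Bool) (Fin n → Bool) ℝ :=
  fun x y => exclusionOp c rp rm (fun z => if z = y then 1 else 0) x

/-- The Laplace matrix of the network: `Δ i j = c i j` off the diagonal and
`Δ i i = -rp i - rm i - ∑_{k ≠ i} c i k`. -/
noncomputable def laplace {n : ℕ} (c : Fin n → Fin n → ℝ) (rp rm : Fin n → ℝ) :
    Matrix (Fin n) (Fin n) ℝ :=
  fun i j => if j = i then -rp i - rm i - ∑ k ∈ Finset.univ.erase i, c i k else c i j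

/-- The support of `c` connects the sites. -/
def ConnectsSites {n : ℕ} (c : Fin n → Fin n → ℝ) : Prop :=
  ∀ i j : Fin n, Relation.ReflTransGen (fun a b : Fin n => 0 < c a b) i j

theorem laplace_mulVec {n : ℕ} (c : Fin n → Fin n → ℝ) (rp rm v : Fin n → ℝ) (i : Fin n) :
    (laplace c rp rm).mulVec v i = -(rp i + rm i) * v i + ∑ j, c i j * (v j - v i) := by
  have h : ∀ w : Fin n → ℝ, ∑ j, w j = w i + ∑ j ∈ Finset.univ.erase i, w j := fun w =>
    (Finset.add_sum_erase _ _ (Finset.mem_univ i)).symm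
  simp only [Matrix.mulVec, dotProduct, laplace]
  rw [h, h]
  have h1 : ∑ j ∈ Finset.univ.erase i,
      (if j = i then -rp i - rm i - ∑ k ∈ Finset.univ.erase i, c i k else c i j) * v j =
      ∑ j ∈ Finset.univ.erase i, c i j * v j :=
    Finset.sum_congr rfl fun j hj => by rw [if_neg (Finset.ne_of_mem_erase hj)]
  rw [h1]
  simp only [if_true, mul_sub, Finset.sum_sub_distrib, ← Finset.sum_mul]
  ring

/-- The bilinear form of the Laplace matrix in Dirichlet form. -/
theorem sum_mul_laplace_mulVec {n : ℕ} (c : Fin n → Fin n → ℝ) (rp rm : Fin n → ℝ)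
    (hsym : ∀ i j, c i j = c j i) (a v : Fin n → ℝ) :
    ∑ i, a i * (laplace c rp rm).mulVec v i =
      (1 / 2) * ∑ i, ∑ j, c i j * ((v i - v j) * (a j - a i))
        - ∑ i, (rp i + rm i) * (v i * a i) := by
  have h : ∑ i, ∑ j, a i * (c i j * (v j - v i)) = ∑ i, ∑ j, a j * (c i j * (v i - v j)) := by
    rw [Finset.sum_comm]
    exact Finset.sum_congr rfl fun i _ => Finset.sum_congr rfl fun j _ => by rw [hsym]
  have h2 : ∑ i, ∑ j, c i j * ((v i - v j) * (a j - a i)) =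
      ∑ i, ∑ j, a i * (c i j * (v j - v i)) + ∑ i, ∑ j, a j * (c i j * (v i - v j)) := by
    simp only [← Finset.sum_add_distrib]
    exact Finset.sum_congr rfl fun i _ => Finset.sum_congr rfl fun j _ => by ring
  rw [h2, ← h]
  simp only [laplace_mulVec, mul_add, Finset.sum_add_distrib, Finset.mul_sum]
  have h3 : ∑ i, a i * (-(rp i + rm i) * v i) = -∑ i, (rp i + rm i) * (v i * a i) := by
    rw [← Finset.sum_neg_distrib]
    exact Finset.sum_congr rfl fun i _ => by ring
  rw [h3]
  simp only [← Finset.mul_sum]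
  ring

theorem sum_mul_laplace_mulVec_comm {n : ℕ} (c : Fin n → Fin n → ℝ) (rp rm : Fin n → ℝ)
    (hsym : ∀ i j, c i j = c j i) (a v : Fin n → ℝ) :
    ∑ i, a i * (laplace c rp rm).mulVec v i = ∑ i, v i * (laplace c rp rm).mulVec a i := by
  rw [sum_mul_laplace_mulVec c rp rm hsym, sum_mul_laplace_mulVec c rp rm hsym]
  congr 1
  · congr 1
    exact Finset.sum_congr rfl fun i _ => Finset.sum_congr rfl fun j _ => by ring
  · exact Finset.sum_congr rfl fun i _ => by ring

theorem sum_mul_comp_swap_sub {n : ℕ} (v a : Fin n → ℝ) (i j : Fin n) :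
    ∑ k, v k * (a (Equiv.swap i j k) - a k) = (v i - v j) * (a j - a i) := by
  rcases eq_or_ne i j with rfl | hij
  · simp
  · rw [Fintype.sum_eq_add i j hij]
    · rw [Equiv.swap_apply_left, Equiv.swap_apply_right]
      ring
    · rintro k ⟨hi, hj⟩
      rw [Equiv.swap_apply_of_ne_of_ne hi hj, sub_self, mul_zero]

theorem sum_mul_update_sub {n : ℕ} (v p : Fin n → ℝ) (x : Fin n → Bool) (i : Fin n) (b : Bool) :
    ∑ k, v k * ((if Function.update x i b k then (1 : ℝ) else 0) - p k)
      - ∑ k, v k * ((if x k then (1 : ℝ) else 0) - p k) =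
    v i * ((if b then 1 else 0) - if x i then 1 else 0) := by
  rw [← Finset.sum_sub_distrib, Fintype.sum_eq_single i]
  · rw [Function.update_self]
    ring
  · intro k hk
    rw [Function.update_of_ne hk, sub_self]

/-- **Eigenfunction of the exclusion generator.** If `Δ v = -λ v` and `p = (-Δ)⁻¹ r⁺`,
then `f(x) = ∑ᵢ vᵢ (xᵢ - pᵢ)` satisfies `L f = -λ f`. -/
theorem exclusion_eigenfunction {n : ℕ} (c : Fin n → Fin n → ℝ) (rp rm : Fin n → ℝ)
    (hsym : ∀ i j, c i j = c j i) (hc : ∀ i j, 0 ≤ c i j) (hrp : ∀ i, 0 ≤ rp i)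
    (hrm : ∀ i, 0 ≤ rm i) (hconn : ConnectsSites c) (hp' : ∃ i, 0 < rp i)
    (hm' : ∃ i, 0 < rm i) (l : ℝ) (v : Fin n → ℝ)
    (hv : (laplace c rp rm).mulVec v = (-l) • v) (p : Fin n → ℝ)
    (hp : (-(laplace c rp rm)).mulVec p = rp) :
    ∀ x : Fin n → Bool,
      exclusionOp c rp rm
          (fun z => ∑ i, v i * ((if z i then (1 : ℝ) else 0) - p i)) x =
        -l * ∑ i, v i * ((if x i then (1 : ℝ) else 0) - p i) := by
  intro x
  have hswap : ∀ i j, ∑ k, v k * ((if (x ∘ Equiv.swap i j) k then (1 : ℝ) else 0) - p k)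
      - ∑ k, v k * ((if x k then (1 : ℝ) else 0) - p k) =
      (v i - v j) * ((if x j then 1 else 0) - if x i then 1 else 0) := fun i j => by
    rw [← sum_mul_comp_swap_sub v (fun k => if x k then 1 else 0), ← Finset.sum_sub_distrib]
    exact Finset.sum_congr rfl fun k _ => by simp only [Function.comp_apply]; ring
  simp only [exclusionOp, hswap, sum_mul_update_sub, if_true, Bool.false_eq_true, if_false]
  have hdir := sum_mul_laplace_mulVec c rp rm hsym (fun k => if x k then 1 else 0) v
  have hcomm := sum_mul_laplace_mulVec_comm c rp rm hsym p v
  have hΔp : (laplace c rp rm).mulVec p = -rp := by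
    rwa [Matrix.neg_mulVec, neg_eq_iff_eq_neg] at hp
  rw [hv] at hdir hcomm
  rw [hΔp] at hcomm
  rw [eq_sub_iff_add_eq] at hdir
  rw [← hdir, add_assoc, add_assoc, ← Finset.sum_add_distrib, ← Finset.sum_add_distrib]
  have hdiag : ∑ i, ((rp i + rm i) * (v i * if x i then 1 else 0)
      + (rp i * (v i * (1 - if x i then 1 else 0))
        + rm i * (v i * (0 - if x i then 1 else 0)))) =
      -∑ i, v i * (-rp) i := by
    rw [← Finset.sum_neg_distrib]
    exact Finset.sum_congr rfl fun i _ => by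
      rw [Pi.neg_apply]; ring
  rw [hdiag, ← hcomm, ← Finset.sum_neg_distrib, ← Finset.sum_add_distrib, Finset.mul_sum]
  exact Finset.sum_congr rfl fun i _ => by simp only [Pi.smul_apply, smul_eq_mul]; ring
end

section
/- Let (c_ij) be a symmetric n×n array with nonnegative entries whose support connects [n], let r^+, r^- be nonnegative vectors with r_i^+ + r_i^- > 0 for at least one i, and let Δ be the associated Laplace matrix. Then the smallest eigenvalue λ of the positive definite matrix −Δ admits an eigenvector v ∈ ℝ^n all of whose entries are strictly positive. -/
open Matrix in
/-- The quadratic form of a real symmetric matrix over a nonempty finite type attains its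
minimum on the Euclidean unit sphere. -/
theorem exists_isMinOn_quadraticForm {ι : Type*} [Fintype ι] [Nonempty ι] (A : Matrix ι ι ℝ) :
    ∃ x : ι → ℝ, x ⬝ᵥ x = 1 ∧ ∀ y : ι → ℝ, y ⬝ᵥ y = 1 → x ⬝ᵥ A *ᵥ x ≤ y ⬝ᵥ A *ᵥ y := by
  classical
  have hcpt : IsCompact {x : ι → ℝ | x ⬝ᵥ x = 1} := by
    refine Metric.isCompact_of_isClosed_isBounded
      (isClosed_eq (by simp only [dotProduct]; fun_prop) continuous_const) ?_
    refine (Metric.isBounded_closedBall (x := (0 : ι → ℝ)) (r := 1)).subset fun x hx => ?_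
    rw [mem_closedBall_zero_iff, pi_norm_le_iff_of_nonneg zero_le_one]
    intro i
    have hi : x i * x i ≤ x ⬝ᵥ x :=
      Finset.single_le_sum (f := fun j => x j * x j) (fun j _ => mul_self_nonneg _)
        (Finset.mem_univ i)
    rw [Real.norm_eq_abs]
    exact abs_le_one_iff_mul_self_le_one.2 (hi.trans_eq hx)
  have hne : {x : ι → ℝ | x ⬝ᵥ x = 1}.Nonempty :=
    ⟨Pi.single (Classical.arbitrary ι) 1, by simp⟩
  obtain ⟨x, hx, hmin⟩ := hcpt.exists_isMinOn hne (f := fun x => x ⬝ᵥ A *ᵥ x)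
    (by simp only [dotProduct, mulVec]; fun_prop)
  exact ⟨x, hx, fun y hy => hmin hy⟩

open Matrix in
/-- Replacing a vector by its entrywise absolute value does not increase the quadratic form of
a matrix with nonpositive off-diagonal entries. -/
theorem abs_dotProduct_mulVec_abs_le {ι : Type*} [Fintype ι] {A : Matrix ι ι ℝ}
    (hA : ∀ i j, i ≠ j → A i j ≤ 0) (x : ι → ℝ) : |x| ⬝ᵥ A *ᵥ |x| ≤ x ⬝ᵥ A *ᵥ x := by
  simp only [dotProduct, mulVec, Finset.mul_sum, Pi.abs_apply]
  refine Finset.sum_le_sum fun i _ => Finset.sum_le_sum fun j _ => ?_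
  obtain rfl | hij := eq_or_ne i j
  · rw [mul_left_comm, abs_mul_abs_self, mul_left_comm]
  · have hle : x i * x j ≤ |x i| * |x j| := (le_abs_self _).trans_eq (abs_mul _ _)
    nlinarith [mul_le_mul_of_nonpos_left hle (hA i j hij)]

open Matrix in
/-- A nonnegative eigenvector of an irreducible matrix with nonpositive off-diagonal entries
is strictly positive. -/
theorem eigenvector_pos_of_nonneg {ι : Type*} [Fintype ι] {A : Matrix ι ι ℝ}
    (hA : ∀ i j, i ≠ j → A i j ≤ 0)
    (hconn : ∀ i j, Relation.ReflTransGen (fun a b => A a b < 0) i j)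
    {v : ι → ℝ} (hv : 0 ≤ v) (hv0 : v ≠ 0) {m : ℝ} (hev : A *ᵥ v = m • v) (i : ι) :
    0 < v i := by
  refine (hv i).lt_of_ne' fun hi => hv0 ?_
  have hstep : ∀ a b, v a = 0 → A a b < 0 → v b = 0 := by
    intro a b ha hab
    have hsum : ∑ j, A a j * v j = 0 := by
      simpa [mulVec, dotProduct, ha] using congrFun hev a
    have hterm : ∀ j ∈ Finset.univ, A a j * v j ≤ 0 := by
      intro j _
      obtain rfl | haj := eq_or_ne a j
      · simp [ha]
      · exact mul_nonpos_of_nonpos_of_nonneg (hA a j haj) (hv j)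
    have hzero := (Finset.sum_eq_zero_iff_of_nonpos hterm).1 hsum b (Finset.mem_univ b)
    exact (mul_eq_zero.1 hzero).resolve_left hab.ne
  funext j
  induction hconn i j with
  | refl => exact hi
  | tail _ hab ih => exact hstep _ _ ih hab

open Matrix in
/-- **Perron–Frobenius** for symmetric irreducible matrices with nonpositive off-diagonal
entries: the smallest eigenvalue has a strictly positive eigenvector. -/
theorem exists_pos_eigenvector_isLeast {ι : Type*} [Fintype ι] [Nonempty ι]
    {A : Matrix ι ι ℝ} (hsymm : A.IsSymm) (hA : ∀ i j, i ≠ j → A i j ≤ 0)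
    (hconn : ∀ i j, Relation.ReflTransGen (fun a b => A a b < 0) i j) :
    ∃ (m : ℝ) (v : ι → ℝ), (∀ i, 0 < v i) ∧ A *ᵥ v = m • v ∧
      IsLeast {l : ℝ | ∃ w : ι → ℝ, w ≠ 0 ∧ A *ᵥ w = l • w} m := by
  classical
  obtain ⟨x, hx, hmin⟩ := exists_isMinOn_quadraticForm A
  set m := x ⬝ᵥ A *ᵥ x
  have hray : ∀ y : ι → ℝ, m * (y ⬝ᵥ y) ≤ y ⬝ᵥ A *ᵥ y := by
    intro y
    obtain rfl | hy := eq_or_ne y 0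
    · simp
    have hpos : 0 < y ⬝ᵥ y := by
      simpa using dotProduct_star_self_pos_iff.2 hy
    have hs : √(y ⬝ᵥ y) * √(y ⬝ᵥ y) = y ⬝ᵥ y := Real.mul_self_sqrt hpos.le
    have hs0 : √(y ⬝ᵥ y) ≠ 0 := (Real.sqrt_pos.2 hpos).ne'
    have hle := hmin ((√(y ⬝ᵥ y))⁻¹ • y) (by
      simp only [smul_dotProduct, dotProduct_smul, smul_eq_mul]
      rw [← mul_assoc, ← mul_inv, hs, inv_mul_cancel₀ hpos.ne'])
    simp only [mulVec_smul, smul_dotProduct, dotProduct_smul, smul_eq_mul] at hle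
    rw [← mul_assoc, ← mul_inv, hs, inv_mul_eq_div] at hle
    exact (le_div_iff₀ hpos).1 hle
  have habs : |x| ⬝ᵥ |x| = 1 := by
    simpa [dotProduct] using hx
  have hform : ∀ y : ι → ℝ, y ⬝ᵥ (A - m • (1 : Matrix ι ι ℝ)) *ᵥ y =
      y ⬝ᵥ A *ᵥ y - m * (y ⬝ᵥ y) := by
    intro y
    simp [sub_mulVec, smul_mulVec, dotProduct_sub]
  have hpsd : (A - m • (1 : Matrix ι ι ℝ)).PosSemidef := by
    refine PosSemidef.of_dotProduct_mulVec_nonneg ?_ fun y => ?_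
    · simp [IsHermitian, conjTranspose_eq_transpose_of_trivial, hsymm.eq]
    · rw [star_trivial, hform]
      exact sub_nonneg.2 (hray y)
  have hker : (A - m • (1 : Matrix ι ι ℝ)) *ᵥ |x| = 0 := by
    refine (hpsd.dotProduct_mulVec_zero_iff _).1 ?_
    rw [star_trivial, hform, habs, mul_one, sub_eq_zero]
    exact le_antisymm (abs_dotProduct_mulVec_abs_le hA x) (hmin _ habs)
  have hev : A *ᵥ |x| = m • |x| := by
    simpa [sub_mulVec, smul_mulVec, sub_eq_zero] using hker
  have hx0 : |x| ≠ 0 := fun h => by simp [h] at habs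
  refine ⟨m, |x|, eigenvector_pos_of_nonneg hA hconn (abs_nonneg x) hx0 hev, hev,
    ⟨|x|, hx0, hev⟩, ?_⟩
  rintro l ⟨w, hw, hwl⟩
  have hpos : 0 < w ⬝ᵥ w := by simpa using dotProduct_star_self_pos_iff.2 hw
  have hle := hray w
  rw [hwl, dotProduct_smul, smul_eq_mul] at hle
  exact le_of_mul_le_mul_right hle hpos


/-- **Perron eigenvector for the smallest eigenvalue.** The smallest eigenvalue of the
positive definite matrix `-Δ` admits an eigenvector with strictly positive entries. -/
theorem laplace_perron_eigenvector {n : ℕ} (hn : 0 < n) (c : Fin n → Fin n → ℝ)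
    (rp rm : Fin n → ℝ) (hsym : ∀ i j, c i j = c j i) (hc : ∀ i j, 0 ≤ c i j)
    (hrp : ∀ i, 0 ≤ rp i) (hrm : ∀ i, 0 ≤ rm i) (hconn : ConnectsSites c)
    (hres : ∃ i, 0 < rp i + rm i) :
    ∃ v : Fin n → ℝ, (∀ i, 0 < v i) ∧ (-(laplace c rp rm)).mulVec v =
      (sInf {l : ℝ | ∃ w : Fin n → ℝ, w ≠ 0 ∧
        (-(laplace c rp rm)).mulVec w = l • w}) • v := by
  have : Nonempty (Fin n) := ⟨⟨0, hn⟩⟩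
  have hoff : ∀ i j, i ≠ j → (-(laplace c rp rm)) i j = -c i j := by
    intro i j hij
    simp [laplace, hij.symm]
  have hsymm : (-(laplace c rp rm)).IsSymm := by
    refine Matrix.IsSymm.ext fun i j => ?_
    obtain rfl | hij := eq_or_ne i j
    · rfl
    · rw [hoff i j hij, hoff j i hij.symm, hsym i j]
  have hnonpos : ∀ i j, i ≠ j → (-(laplace c rp rm)) i j ≤ 0 := by
    intro i j hij
    rw [hoff i j hij]
    exact neg_nonpos.2 (hc i j)
  have hirred : ∀ i j : Fin n,
      Relation.ReflTransGen (fun a b => (-(laplace c rp rm)) a b < 0) i j := by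
    intro i j
    induction hconn i j with
    | refl => exact .refl
    | @tail a b _ hab ih =>
      obtain rfl | hne := eq_or_ne a b
      · exact ih
      · refine ih.tail ?_
        rw [hoff a b hne]
        exact neg_lt_zero.2 hab
  obtain ⟨m, v, hv, hev, hleast⟩ := exists_pos_eigenvector_isLeast hsymm hnonpos hirred
  exact ⟨v, hv, by rw [hleast.csInf_eq, hev]⟩
end
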